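/- Let P be a directed set with the property that every compact Hausdorff space X such that X²∖Δ is P-paracompact must be metrizable. Then P has calibre (ω₁,ω). -/

import Mathlib

open Set TopologicalSpace Topology

/-- A family of sets is locally finite at a point `x`: `x` has a neighborhood meeting
only finitely many members of the family. -/
def LocallyFiniteAt {X : Type*} [TopologicalSpace X] (x : X) (C : Set (Set X)) : Prop :=
  ∃ U ∈ nhds x, {A ∈ C | (A ∩ U).Nonempty}.Finite

/-- A family of sets is locally finite in `X`. -/
def LocallyFiniteFamily {X : Type*} [TopologicalSpace X] (C : Set (Set X)) : Prop :=
  ∀ x : X, LocallyFiniteAt x C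

/-- A poset is directed: every pair of elements has an upper bound. -/
def DirectedPoset (P : Type*) [Preorder P] : Prop :=
  ∀ a b : P, ∃ c : P, a ≤ c ∧ b ≤ c

/-- A poset has calibre (ω₁,ω) if every uncountable subset contains an infinite
subset with an upper bound. -/
def CalibreOmega1Omega (P : Type*) [Preorder P] : Prop :=
  ∀ S : Set P, ¬ S.Countable → ∃ T ⊆ S, T.Infinite ∧ ∃ b : P, ∀ t ∈ T, t ≤ b

/-- A collection `C` of subsets of `X` is `P`-locally finite. -/
def PLocallyFinite (P : Type*) [Preorder P] {X : Type*} [TopologicalSpace X]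
    (C : Set (Set X)) : Prop :=
  ∃ c : P → Set (Set X), (∀ p p' : P, p ≤ p' → c p ⊆ c p') ∧
    (∀ p, LocallyFiniteFamily (c p)) ∧ (⋃ p, c p) = C

def IsOpenCover {X : Type*} [TopologicalSpace X] (U : Set (Set X)) : Prop :=
  (∀ V ∈ U, IsOpen V) ∧ ⋃₀ U = univ

def IsRefinement {X : Type*} (V U : Set (Set X)) : Prop :=
  ∀ W ∈ V, ∃ W' ∈ U, W ⊆ W'

/-- `X` is `P`-paracompact: every open cover has a `P`-locally finite open refinement. -/
def PParacompact (P : Type*) [Preorder P] (X : Type*) [TopologicalSpace X] : Prop :=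
  ∀ U : Set (Set X), IsOpenCover U →
    ∃ V : Set (Set X), IsOpenCover V ∧ IsRefinement V U ∧ PLocallyFinite P V

/-- A collection is (ω₁,ω)-locally finite: every uncountable subcollection contains
an infinite locally finite subcollection. -/
def Omega1OmegaLF {X : Type*} [TopologicalSpace X] (C : Set (Set X)) : Prop :=
  ∀ D ⊆ C, ¬ D.Countable → ∃ E ⊆ D, E.Infinite ∧ LocallyFiniteFamily E

def Omega1OmegaParacompact (X : Type*) [TopologicalSpace X] : Prop :=
  ∀ U : Set (Set X), IsOpenCover U →
    ∃ V : Set (Set X), IsOpenCover V ∧ IsRefinement V U ∧ Omega1OmegaLF V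

/-- `B` is a base for the topology of `X`. -/
def IsBase {X : Type*} [TopologicalSpace X] (B : Set (Set X)) : Prop :=
  (∀ b ∈ B, IsOpen b) ∧ ∀ U : Set X, IsOpen U → ∀ x ∈ U, ∃ b ∈ B, x ∈ b ∧ b ⊆ U

/-- `X` is `P`-metrizable: it has a `(P × ℕ)`-locally finite base. -/
def PMetrizable (P : Type*) [Preorder P] (X : Type*) [TopologicalSpace X] : Prop :=
  ∃ B : Set (Set X), IsBase B ∧ PLocallyFinite (P × ℕ) B

def Omega1OmegaMetrizable (X : Type*) [TopologicalSpace X] : Prop :=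
  ∃ B : Set (Set X), IsBase B ∧ Omega1OmegaLF B

/-- Pseudocompact: every locally finite family of nonempty open sets is finite. -/
def Pseudocompact (X : Type*) [TopologicalSpace X] : Prop :=
  ∀ C : Set (Set X), (∀ U ∈ C, IsOpen U ∧ U.Nonempty) → LocallyFiniteFamily C → C.Finite

/-- The directed set of compact subsets of `M`, ordered by inclusion. -/
abbrev KM (M : Type*) [TopologicalSpace M] : Type _ := {K : Set M // IsCompact K}

/-- `X` is 𝒦(𝓜)-paracompact: every open cover has a `𝒦(M)`-locally finite open
refinement for some separable metrizable `M`. -/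
def KMclassParacompact (X : Type*) [TopologicalSpace X] : Prop :=
  ∀ U : Set (Set X), IsOpenCover U →
    ∃ (M : Type) (_ : TopologicalSpace M), SeparableSpace M ∧ MetrizableSpace M ∧
      ∃ V : Set (Set X), IsOpenCover V ∧ IsRefinement V U ∧ PLocallyFinite (KM M) V

/-- Weakly σ-locally finite collection. -/
def WeaklySigmaLF {X : Type*} [TopologicalSpace X] (C : Set (Set X)) : Prop :=
  ∃ c : ℕ → Set (Set X), (⋃ n, c n) = C ∧
    ∀ x : X, ∀ A ∈ C, ∃ n, A ∈ c n ∧ LocallyFiniteAt x (c n)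

/-- Relatively locally finite: locally finite at every point of its union. -/
def RelLocallyFinite {X : Type*} [TopologicalSpace X] (C : Set (Set X)) : Prop :=
  ∀ x ∈ ⋃₀ C, LocallyFiniteAt x C

def SigmaRelLF {X : Type*} [TopologicalSpace X] (C : Set (Set X)) : Prop :=
  ∃ c : ℕ → Set (Set X), (⋃ n, c n) = C ∧ ∀ n, RelLocallyFinite (c n)

def SigmaRelParacompact (X : Type*) [TopologicalSpace X] : Prop :=
  ∀ U : Set (Set X), IsOpenCover U →
    ∃ V : Set (Set X), IsOpenCover V ∧ IsRefinement V U ∧ SigmaRelLF V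

/-- An open set `U` is `P`-regular. -/
def PRegular (P : Type*) [Preorder P] {X : Type*} [TopologicalSpace X] (U : Set X) : Prop :=
  ∃ V : P × ℕ → Set X, (∀ q, IsOpen (V q)) ∧ (∀ q q' : P × ℕ, q ≤ q' → V q ⊆ V q') ∧
    (⋃ q, V q) = U ∧ (⋃ q, closure (V q)) = U

def PPerfectlyNormal (P : Type*) [Preorder P] (X : Type*) [TopologicalSpace X] : Prop :=
  ∀ U : Set X, IsOpen U → PRegular P U

/-- A development for `X`. -/
def IsDevelopment {X : Type*} [TopologicalSpace X] (G : ℕ → Set (Set X)) : Prop :=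
  (∀ n, IsOpenCover (G n)) ∧
    ∀ (x : X) (U : Set X), IsOpen U → x ∈ U → ∃ n, ⋃₀ {g ∈ G n | x ∈ g} ⊆ U

/-- A Moore space is a regular Hausdorff space with a development; here we record
just the existence of a development (regularity is a separate hypothesis). -/
def HasDevelopment (X : Type*) [TopologicalSpace X] : Prop :=
  ∃ G : ℕ → Set (Set X), IsDevelopment G

/-- Countably paracompact: every countable open cover has a locally finite open refinement. -/
def CountablyParacompact (X : Type*) [TopologicalSpace X] : Prop :=
  ∀ U : Set (Set X), IsOpenCover U → U.Countable →
    ∃ V : Set (Set X), IsOpenCover V ∧ IsRefinement V U ∧ LocallyFiniteFamily V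

/-- ccc: every pairwise disjoint family of nonempty open sets is countable. -/
def CCC (X : Type*) [TopologicalSpace X] : Prop :=
  ∀ C : Set (Set X), (∀ U ∈ C, IsOpen U ∧ U.Nonempty) → C.Pairwise Disjoint → C.Countable

/-- Cofinal subset of a preorder. -/
def CofinalSet {P : Type*} [Preorder P] (C : Set P) : Prop :=
  ∀ p : P, ∃ c ∈ C, p ≤ c

/-- `Q` is a Tukey quotient of `P`. -/
def TukeyQuotient (P : Type*) [Preorder P] (Q : Type*) [Preorder Q] : Prop :=
  ∃ φ : P → Q, ∀ C : Set P, CofinalSet C → CofinalSet (φ '' C)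
/-- If `P` is a directed set such that every compact Hausdorff space `X`
with `X² ∖ Δ` `P`-paracompact is metrizable, then `P` has calibre (ω₁,ω). -/
theorem statement1.{u, v} (P : Type v) [PartialOrder P] (hdir : DirectedPoset P)
    (h : ∀ (X : Type u) [TopologicalSpace X] [CompactSpace X] [T2Space X],
      PParacompact P {p : X × X // p.1 ≠ p.2} → MetrizableSpace X) :
    CalibreOmega1Omega P := by
  intro S hS
  by_contra hcon
  push Not at hcon
  have hfin : ∀ p : P, {s ∈ S | s ≤ p}.Finite := by
    intro p
    by_contra hinf
    obtain ⟨t, ht, hn⟩ := hcon {s ∈ S | s ≤ p} (fun s hs => hs.1) hinf p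
    exact hn ht.2
  -- a discrete set of size ℵ₁ in universe `u`, injected into `S`
  obtain ⟨D, hD⟩ : ∃ D : Type u, Cardinal.mk D = Cardinal.aleph 1 :=
    ⟨_, Cardinal.mk_out (Cardinal.aleph 1)⟩
  have hle : Cardinal.lift.{v} (Cardinal.mk D) ≤ Cardinal.lift.{u} (Cardinal.mk S) := by
    have h1 : Cardinal.aleph 1 ≤ Cardinal.mk S := by
      rw [← Cardinal.succ_aleph0, Order.succ_le_iff]
      by_contra hc
      exact hS (Cardinal.mk_le_aleph0_iff.1 (not_lt.1 hc) |>.to_set)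
    rw [hD]
    have h2 := Cardinal.lift_le.{u}.2 h1
    simpa using h2
  obtain ⟨f⟩ := Cardinal.lift_mk_le'.1 hle
  have hDunc : ¬ Countable D := by
    intro hc
    have := Cardinal.mk_le_aleph0_iff.2 hc
    rw [hD] at this
    exact absurd this (not_le.2 Cardinal.aleph0_lt_aleph_one)
  letI : TopologicalSpace D := ⊥
  haveI : DiscreteTopology D := ⟨rfl⟩
  have hmet : MetrizableSpace (OnePoint D) := by
    apply h
    intro U hU
    have hop : ∀ d : D, IsOpen ({(d : OnePoint D)} : Set (OnePoint D)) := by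
      intro d
      have := (OnePoint.isOpenEmbedding_coe (X := D)).isOpenMap {d} (isOpen_discrete _)
      simpa using this
    let K : D → Set {p : OnePoint D × OnePoint D // p.1 ≠ p.2} :=
      fun d => {q | q.1.1 = (d : OnePoint D) ∨ q.1.2 = (d : OnePoint D)}
    have hKo : ∀ d, IsOpen (K d) := by
      intro d
      refine IsOpen.union (IsOpen.preimage (continuous_fst.comp continuous_subtype_val) (hop d))
        (IsOpen.preimage (continuous_snd.comp continuous_subtype_val) (hop d))
    have hKc : ∀ d, IsCompact (K d) := by
      intro d
      rw [Subtype.isCompact_iff]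
      have hc : IsCompact ({(d : OnePoint D)}ᶜ : Set (OnePoint D)) :=
        (hop d).isClosed_compl.isCompact
      have he : (Subtype.val '' K d) =
          ({(d : OnePoint D)} ×ˢ {(d : OnePoint D)}ᶜ) ∪
            ({(d : OnePoint D)}ᶜ ×ˢ {(d : OnePoint D)}) := by
        ext ⟨a, b⟩
        simp only [K, mem_image, mem_setOf_eq, Subtype.exists, mem_union, mem_prod,
          mem_singleton_iff, mem_compl_iff, exists_and_left, exists_prop]
        constructor
        · rintro ⟨⟨x, y⟩, h1, h2, h3⟩
          grind
        · intro h1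
          refine ⟨(a, b), ?_, ?_, rfl⟩ <;> grind
      rw [he]
      exact (isCompact_singleton.prod hc).union (hc.prod isCompact_singleton)
    have hV : ∀ d, ∃ T ⊆ U, T.Finite ∧ K d ⊆ ⋃₀ T := by
      intro d
      obtain ⟨T, h1, h2, h3⟩ := (hKc d).elim_finite_subcover_image (b := U) (c := id) hU.1
        (by simp only [id]; rw [← sUnion_eq_biUnion (s := U)]; rw [hU.2]; exact subset_univ _)
      exact ⟨T, h1, h2, by rw [sUnion_eq_biUnion]; exact h3⟩
    choose T hTU hTf hTc using hV
    let c : P → Set (Set {p : OnePoint D × OnePoint D // p.1 ≠ p.2}) :=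
      fun p => ⋃ d ∈ {d : D | (f d : P) ≤ p}, (fun W => W ∩ K d) '' T d
    refine ⟨⋃ p, c p, ⟨?_, ?_⟩, ?_, c, ?_, ?_, rfl⟩
    · intro V hV
      simp only [c, mem_iUnion] at hV
      obtain ⟨p, d, hd, W, hW, rfl⟩ := hV
      exact (hU.1 W (hTU d hW)).inter (hKo d)
    · rw [eq_univ_iff_forall]
      intro q
      have hq : ∃ d, q ∈ K d := by
        obtain ⟨⟨a, b⟩, hab⟩ := q
        induction a using OnePoint.rec with
        | coe d => exact ⟨d, Or.inl rfl⟩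
        | infty =>
          induction b using OnePoint.rec with
          | coe d => exact ⟨d, Or.inr rfl⟩
          | infty => exact absurd rfl hab
      obtain ⟨d, hd⟩ := hq
      obtain ⟨W, hW, hqW⟩ := hTc d hd
      refine ⟨W ∩ K d, ?_, hqW, hd⟩
      simp only [c, mem_iUnion]
      exact ⟨f d, d, le_refl _, W, hW, rfl⟩
    · intro V hV
      simp only [c, mem_iUnion] at hV
      obtain ⟨p, d, hd, W, hW, rfl⟩ := hV
      exact ⟨W, hTU d hW, inter_subset_left⟩
    · intro p p' hp
      exact biUnion_subset_biUnion_left (fun d hd => le_trans hd hp)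
    · intro p x
      refine ⟨univ, Filter.univ_mem, Finite.subset ?_ (sep_subset _ _)⟩
      refine Finite.biUnion ?_ (fun d _ => (hTf d).image _)
      refine Finite.of_finite_image (f := fun d => (f d : P)) ((hfin p).subset ?_) ?_
      · rintro _ ⟨d, hd, rfl⟩
        exact ⟨(f d).2, hd⟩
      · exact (Subtype.val_injective.comp f.injective).injOn
  letI := metrizableSpaceMetric (OnePoint D)
  haveI : SecondCountableTopology (OnePoint D) := inferInstance
  haveI : SecondCountableTopology D :=
    (OnePoint.isOpenEmbedding_coe (X := D)).isEmbedding.secondCountableTopology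
  exact hDunc (TopologicalSpace.separableSpace_iff_countable.1 inferInstance)
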